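/- Let $(M,g)$ be a smooth Riemannian manifold of dimension $n\ge 3$ with Levi-Civita connection $\nabla$ and curvature tensor $R(X,Y)Z=\nabla_X\nabla_YZ-\nabla_Y\nabla_XZ-\nabla_{[X,Y]}Z$, and let $g^s$ be the Sasaki metric on $TM$, i.e. $g^s(X^h,Y^h)=g^s(X^v,Y^v)=g(X,Y)$ and $g^s(X^h,Y^v)=0$, where $X^h$ and $X^v$ are the horizontal (with respect to $\nabla$) and vertical lifts of $X$. A Riemannian manifold $(N,h)$ with Levi-Civita connection $\nabla$ and curvature tensor $R$ is called weakly symmetric if there are smooth 1-forms $\alpha_1,\alpha_2$ on $N$ such that $$(\nabla_WR)(X,Y)Z=\alpha_1(W)R(X,Y)Z+\alpha_2(X)R(W,Y)Z+\alpha_2(Y)R(X,W)Z+\alpha_2(Z)R(X,Y)W+h(R(X,Y)Z,W)\,\alpha_2^\sharp$$ for all vector fields $X,Y,Z,W$; recurrent if this holds for some $\alpha_1$ with $\alpha_2=0$; pseudo-symmetric if it holds for some $\alpha_2$ with $\alpha_1=2\alpha_2$; and locally symmetric if $\nabla R=0$. Then $(TM,g^s)$ is weakly symmetric if and only if $(M,g)$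 is flat ($R\equiv 0$); likewise $(TM,g^s)$ is recurrent, respectively pseudo-symmetric, respectively locally symmetric, if and only if $(M,g)$ is flat. Moreover, in this case $(TM,g^s)$ is flat. -/

import Mathlib

set_option maxSynthPendingDepth 3

open Manifold
open scoped ContDiff

noncomputable section

namespace SasakiLift

/-! ### Riemannian geometry of a metric `G` on (an open subset of) a vector space `F` -/

section Coordinates

variable {F : Type*} [NormedAddCommGroup F] [NormedSpace ℝ F]

/-- The Christoffel symbols of the first kind of the metric `G` in coordinates, without the
factor `1/2`: `(v,w,z) ↦ (∂ᵥ G)(w,z) + (∂_w G)(v,z) − (∂_z G)(v,w)`. -/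
def christoffelLower (G : F → F →L[ℝ] F →L[ℝ] ℝ) (u : F) : F →L[ℝ] F →L[ℝ] F →L[ℝ] ℝ :=
  let D : F →L[ℝ] F →L[ℝ] F →L[ℝ] ℝ := fderiv ℝ G u
  let T : F →L[ℝ] F →L[ℝ] F →L[ℝ] ℝ :=
    (ContinuousLinearMap.flipₗᵢ ℝ F F ℝ).toContinuousLinearEquiv.toContinuousLinearMap.comp D.flip
  D + D.flip - T

theorem christoffelLower_apply (G : F → F →L[ℝ] F →L[ℝ] ℝ) (u v w z : F) :
    christoffelLower G u v w z
      = fderiv ℝ G u v w z + fderiv ℝ G u w v z - fderiv ℝ G u z v w := rfl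

/-- The Christoffel symbols `Γ(v,w) = vⁱ wʲ Γᵢⱼᵏ ∂ₖ` at `u` of the metric `G` in coordinates,
determined by `2 G(Γ(v,w), z) = (∂ᵥ G)(w,z) + (∂_w G)(v,z) − (∂_z G)(v,w)`;
the index is raised with the inverse of `G u : F → F*`. -/
def christoffel (G : F → F →L[ℝ] F →L[ℝ] ℝ) (u : F) : F →L[ℝ] F →L[ℝ] F :=
  (1 / 2 : ℝ) • (ContinuousLinearMap.compL ℝ F (F →L[ℝ] ℝ) F (G u).inverse).comp
    (christoffelLower G u)

theorem christoffel_apply (G : F → F →L[ℝ] F →L[ℝ] ℝ) (u v w : F) :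
    christoffel G u v w = (1 / 2 : ℝ) • (G u).inverse (christoffelLower G u v w) := rfl

/-- The Levi-Civita derivative `(∇ᵥ Y)(u) = (∂ᵥ Y)(u) + Γ(v, Y(u))` of a vector field `Y`
in coordinates. -/
def covDeriv (G : F → F →L[ℝ] F →L[ℝ] ℝ) (v : F) (Y : F → F) (u : F) : F :=
  fderiv ℝ Y u v + christoffel G u v (Y u)

/-- The Riemann tensor `R(x,y)z = ∇ₓ∇_y z − ∇_y∇ₓ z` in coordinates, computed with the
constant-coefficient fields `x, y, z`: their brackets vanish and `∇_y z = Γ(y,z)`. -/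
def curvature (G : F → F →L[ℝ] F →L[ℝ] ℝ) (u x y z : F) : F :=
  covDeriv G x (fun u' => christoffel G u' y z) u - covDeriv G y (fun u' => christoffel G u' x z) u

/-- The tensor `(∇_w R)(x,y)z` in coordinates, computed with constant-coefficient fields. -/
def covDerivCurvature (G : F → F →L[ℝ] F →L[ℝ] ℝ) (u w x y z : F) : F :=
  covDeriv G w (fun u' => curvature G u' x y z) u
    - curvature G u (christoffel G u w x) y z
    - curvature G u x (christoffel G u w y) z
    - curvature G u x y (christoffel G u w z)

end Coordinates

/-! ### Riemannian geometry of a manifold (without boundary)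

A metric is given by its inner products `h x` on the tangent spaces. Recall that in Mathlib
`TangentSpace I x` is the model vector space `E`, a tangent vector at `x` being identified with its
components in the preferred chart at `x`. -/

section Manifold

variable {E : Type*} [NormedAddCommGroup E] [NormedSpace ℝ E]
  {H : Type*} [TopologicalSpace H] (I : ModelWithCorners ℝ E H)
  {N : Type*} [TopologicalSpace N] [ChartedSpace H N] [IsManifold I 1 N]

/-- The coordinate expression `u ↦ (g_ij(u))` of the metric `h` in the preferred chart at `x`:
`symmL` of the tangent bundle trivialization at `x` is the differential of the inverse chart. -/
def metricInChart (h : ∀ x : N, TangentSpace I x →L[ℝ] TangentSpace I x →L[ℝ] ℝ) (x : N) (u : E) :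
    E →L[ℝ] E →L[ℝ] ℝ :=
  ContinuousLinearMap.bilinearComp (E := E) (F := E)
    (h ((extChartAt I x).symm u))
    ((trivializationAt E (TangentSpace I : N → Type _) x).symmL ℝ ((extChartAt I x).symm u))
    ((trivializationAt E (TangentSpace I : N → Type _) x).symmL ℝ ((extChartAt I x).symm u))

variable (h : ∀ x : N, TangentSpace I x →L[ℝ] TangentSpace I x →L[ℝ] ℝ)

/-- The Riemann curvature tensor `R(X,Y)Z` of `(N,h)` at `x`. -/
def riemann (x : N) (X Y Z : TangentSpace I x) : TangentSpace I x :=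
  curvature (F := E) (metricInChart I h x) (extChartAt I x x) X Y Z

/-- The covariant derivative `(∇_W R)(X,Y)Z` of the Riemann curvature tensor of `(N,h)` at `x`. -/
def nablaRiemann (x : N) (W X Y Z : TangentSpace I x) : TangentSpace I x :=
  covDerivCurvature (F := E) (metricInChart I h x) (extChartAt I x x) W X Y Z

/-- The tangent vector `α^♯` at `x` with `h(α^♯, ·) = α`. -/
def sharp (x : N) (α : TangentSpace I x →L[ℝ] ℝ) : TangentSpace I x :=
  (h x).inverse α

/-- `α` is a (smooth) 1-form on `N`. -/
def IsOneForm (α : ∀ x : N, TangentSpace I x →L[ℝ] ℝ) : Prop :=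
  ContMDiff I (I.prod 𝓘(ℝ, E →L[ℝ] ℝ)) ∞
    (fun x => Bundle.TotalSpace.mk' (E →L[ℝ] ℝ) (E := fun x : N => TangentSpace I x →L[ℝ] ℝ) x (α x))

/-- `(N,h)` is flat: `R ≡ 0`. -/
def IsFlat : Prop :=
  ∀ (x : N) (X Y Z : TangentSpace I x), riemann I h x X Y Z = 0

/-- `(N,h)` is weakly symmetric. -/
def IsWeaklySymmetric : Prop :=
  ∃ α₁ α₂ : ∀ x : N, TangentSpace I x →L[ℝ] ℝ, IsOneForm I α₁ ∧ IsOneForm I α₂ ∧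
    ∀ (x : N) (W X Y Z : TangentSpace I x),
      nablaRiemann I h x W X Y Z =
        α₁ x W • riemann I h x X Y Z + α₂ x X • riemann I h x W Y Z
          + α₂ x Y • riemann I h x X W Z + α₂ x Z • riemann I h x X Y W
          + h x (riemann I h x X Y Z) W • sharp I h x (α₂ x)

/-- `(N,h)` is recurrent: the case `α₂ = 0` of weak symmetry. -/
def IsRecurrent : Prop :=
  ∃ α₁ : ∀ x : N, TangentSpace I x →L[ℝ] ℝ, IsOneForm I α₁ ∧
    ∀ (x : N) (W X Y Z : TangentSpace I x),
      nablaRiemann I h x W X Y Z = α₁ x W • riemann I h x X Y Z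

/-- `(N,h)` is pseudo-symmetric: the case `α₁ = 2 α₂` of weak symmetry. -/
def IsPseudoSymmetric : Prop :=
  ∃ α₂ : ∀ x : N, TangentSpace I x →L[ℝ] ℝ, IsOneForm I α₂ ∧
    ∀ (x : N) (W X Y Z : TangentSpace I x),
      nablaRiemann I h x W X Y Z =
        (2 * α₂ x W) • riemann I h x X Y Z + α₂ x X • riemann I h x W Y Z
          + α₂ x Y • riemann I h x X W Z + α₂ x Z • riemann I h x X Y W
          + h x (riemann I h x X Y Z) W • sharp I h x (α₂ x)

/-- `(N,h)` is locally symmetric: `∇R ≡ 0`. -/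
def IsLocallySymmetric : Prop :=
  ∀ (x : N) (W X Y Z : TangentSpace I x), nablaRiemann I h x W X Y Z = 0

end Manifold

/-! ### The Sasaki metric

Let `p = (x, y)` be a point of `TM`. The preferred chart of `TM` at `p` is the one induced by the
preferred chart of `M` at `x`, so a tangent vector to `TM` at `p` is a pair `(a, b) : E × E`, standing
for `aⁱ ∂/∂xⁱ + bⁱ ∂/∂yⁱ`. -/

section Sasaki

variable {E : Type*} [NormedAddCommGroup E] [NormedSpace ℝ E]
  {H : Type*} [TopologicalSpace H] (I : ModelWithCorners ℝ E H)
  {M : Type*} [TopologicalSpace M] [ChartedSpace H M] [IsManifold I 1 M]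
  (g : ∀ x : M, TangentSpace I x →L[ℝ] TangentSpace I x →L[ℝ] ℝ)

/-- The Christoffel symbols of `g` at `x`, in the preferred chart at `x`. -/
def christoffelAt (x : M) : E →L[ℝ] E →L[ℝ] E :=
  christoffel (metricInChart I g x) (extChartAt I x x)

/-- The horizontal lift at `p = (x, y)` of `X = Xⁱ ∂/∂xⁱ`, namely
`Xⁱ (∂/∂xⁱ − yᵃ Γₐᵢʲ ∂/∂yʲ)`. -/
def horizontalLift (p : TangentBundle I M) (X : TangentSpace I p.proj) :
    TangentSpace I.tangent p :=
  ((X, -christoffelAt I g p.proj p.snd X) : E × E)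

/-- The vertical lift at `p` of `X = Xⁱ ∂/∂xⁱ`, namely `Xⁱ ∂/∂yⁱ`. -/
def verticalLift (p : TangentBundle I M) (X : TangentSpace I p.proj) :
    TangentSpace I.tangent p :=
  ((0, X) : E × E)

/-- The vector `X` with `hξ = Xʰ`, where `hξ` is the horizontal part of `ξ`. -/
def horizontalPart (_p : TangentBundle I M) : E × E →L[ℝ] E :=
  ContinuousLinearMap.fst ℝ E E

/-- The vector `X` with `vξ = Xᵛ`, where `vξ` is the vertical part of `ξ`. -/
def verticalPart (p : TangentBundle I M) : E × E →L[ℝ] E :=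
  ContinuousLinearMap.snd ℝ E E
    + (christoffelAt I g p.proj p.snd).comp (ContinuousLinearMap.fst ℝ E E)

theorem lift_decomposition (p : TangentBundle I M) (ξ : TangentSpace I.tangent p) :
    ξ = horizontalLift I g p (horizontalPart I p ξ) + verticalLift I p (verticalPart I g p ξ) := by
  refine Prod.ext (?_ : (ξ : E × E).1 = (ξ : E × E).1 + 0)
    (?_ : (ξ : E × E).2 = -christoffelAt I g p.proj p.snd (ξ : E × E).1
      + ((ξ : E × E).2 + christoffelAt I g p.proj p.snd (ξ : E × E).1))
  · simp
  · abel

/-- The Sasaki metric `gˢ` on `TM`; it is characterized by the four lemmas below together with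
`lift_decomposition`. -/
def sasakiMetric (p : TangentBundle I M) :
    TangentSpace I.tangent p →L[ℝ] TangentSpace I.tangent p →L[ℝ] ℝ :=
  (ContinuousLinearMap.bilinearComp (E := E) (F := E) (g p.proj)
      (horizontalPart I p) (horizontalPart I p)
    + ContinuousLinearMap.bilinearComp (E := E) (F := E) (g p.proj)
      (verticalPart I g p) (verticalPart I g p) : E × E →L[ℝ] E × E →L[ℝ] ℝ)

theorem sasakiMetric_apply (p : TangentBundle I M) (ξ η : TangentSpace I.tangent p) :
    sasakiMetric I g p ξ η = g p.proj (horizontalPart I p ξ) (horizontalPart I p η)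
      + g p.proj (verticalPart I g p ξ) (verticalPart I g p η) := rfl

theorem horizontalPart_horizontalLift (p : TangentBundle I M) (X : TangentSpace I p.proj) :
    horizontalPart I p (horizontalLift I g p X) = X := rfl

theorem horizontalPart_verticalLift (p : TangentBundle I M) (X : TangentSpace I p.proj) :
    horizontalPart I p (verticalLift I p X) = 0 := rfl

theorem verticalPart_horizontalLift (p : TangentBundle I M) (X : TangentSpace I p.proj) :
    verticalPart I g p (horizontalLift I g p X) = 0 :=
  neg_add_cancel (christoffelAt I g p.proj p.snd X)

theorem verticalPart_verticalLift (p : TangentBundle I M) (X : TangentSpace I p.proj) :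
    verticalPart I g p (verticalLift I p X) = X := by
  have h0 : christoffelAt I g p.proj p.snd (0 : E) = 0 := map_zero _
  exact (congrArg (HAdd.hAdd (α := E) X) h0).trans (add_zero (M := E) X)

theorem sasakiMetric_hh (p : TangentBundle I M) (X Y : TangentSpace I p.proj) :
    sasakiMetric I g p (horizontalLift I g p X) (horizontalLift I g p Y) = g p.proj X Y := by
  rw [sasakiMetric_apply, verticalPart_horizontalLift, verticalPart_horizontalLift]
  exact (congrArg _ ((g p.proj (0 : TangentSpace I p.proj)).map_zero)).trans (add_zero _)

theorem sasakiMetric_hv (p : TangentBundle I M) (X Y : TangentSpace I p.proj) :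
    sasakiMetric I g p (horizontalLift I g p X) (verticalLift I p Y) = 0 := by
  rw [sasakiMetric_apply, verticalPart_horizontalLift, horizontalPart_verticalLift]
  have h1 := (g p.proj (horizontalPart I p (horizontalLift I g p X))).map_zero
  have h2 := DFunLike.congr_fun ((g p.proj).map_zero) (verticalPart I g p (verticalLift I p Y))
  exact (congrArg₂ (· + ·) h1 h2).trans (add_zero _)

theorem sasakiMetric_vh (p : TangentBundle I M) (X Y : TangentSpace I p.proj) :
    sasakiMetric I g p (verticalLift I p X) (horizontalLift I g p Y) = 0 := by
  rw [sasakiMetric_apply, verticalPart_horizontalLift, horizontalPart_verticalLift]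
  have h1 := (g p.proj (verticalPart I g p (verticalLift I p X))).map_zero
  have h2 := DFunLike.congr_fun ((g p.proj).map_zero) (horizontalPart I p (horizontalLift I g p Y))
  exact (congrArg₂ (· + ·) h2 h1).trans (add_zero _)

theorem sasakiMetric_vv (p : TangentBundle I M) (X Y : TangentSpace I p.proj) :
    sasakiMetric I g p (verticalLift I p X) (verticalLift I p Y) = g p.proj X Y := by
  rw [sasakiMetric_apply, verticalPart_verticalLift, verticalPart_verticalLift,
    horizontalPart_verticalLift, horizontalPart_verticalLift]
  exact (congrArg (· + g p.proj X Y) ((g p.proj (0 : TangentSpace I p.proj)).map_zero)).trans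
    (zero_add _)

end Sasaki

end SasakiLift

end

open SasakiLift

noncomputable section

namespace SasakiLift

open Filter Topology

/-! ### Coordinate metrics -/

section CoordinateMetric

variable {F : Type*} [NormedAddCommGroup F] [NormedSpace ℝ F]

/-- `G` is a smooth Riemannian metric on the open subset `U` of a vector space. -/
structure IsRiemannianOn (G : F → F →L[ℝ] F →L[ℝ] ℝ) (U : Set F) : Prop where
  isOpen : IsOpen U
  contDiffOn : ContDiffOn ℝ ∞ G U
  symm : ∀ u ∈ U, ∀ v w, G u v w = G u w v
  pos : ∀ u ∈ U, ∀ v, v ≠ 0 → 0 < G u v v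

theorem hasFDerivAt_clm_apply_const {X Y Z : Type*} [NormedAddCommGroup X] [NormedSpace ℝ X]
    [NormedAddCommGroup Y] [NormedSpace ℝ Y] [NormedAddCommGroup Z] [NormedSpace ℝ Z]
    {f : X → Y →L[ℝ] Z} {u : X} (hf : DifferentiableAt ℝ f u) (y : Y) :
    HasFDerivAt (fun u' => f u' y) ((fderiv ℝ f u).flip y) u := by
  simpa using hf.hasFDerivAt.clm_apply (hasFDerivAt_const y u)

theorem fderiv_clm_apply_const₂ {X Y Y' Z : Type*} [NormedAddCommGroup X] [NormedSpace ℝ X]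
    [NormedAddCommGroup Y] [NormedSpace ℝ Y] [NormedAddCommGroup Y'] [NormedSpace ℝ Y']
    [NormedAddCommGroup Z] [NormedSpace ℝ Z]
    {f : X → Y →L[ℝ] Y' →L[ℝ] Z} {u : X} (hf : DifferentiableAt ℝ f u) (y : Y) (y' : Y') (x : X) :
    fderiv ℝ (fun u' => f u' y y') u x = fderiv ℝ f u x y y' := by
  have h1 := hasFDerivAt_clm_apply_const hf y
  have h2 := hasFDerivAt_clm_apply_const h1.differentiableAt y'
  rw [h2.fderiv, h1.fderiv]
  rfl

namespace IsRiemannianOn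

variable {G : F → F →L[ℝ] F →L[ℝ] ℝ} {U : Set F} {u : F}

theorem contDiffAt (hG : IsRiemannianOn G U) (hu : u ∈ U) : ContDiffAt ℝ ∞ G u :=
  hG.contDiffOn.contDiffAt (hG.isOpen.mem_nhds hu)

theorem differentiableAt (hG : IsRiemannianOn G U) (hu : u ∈ U) : DifferentiableAt ℝ G u :=
  (hG.contDiffAt hu).differentiableAt (by simp)

theorem ext (hG : IsRiemannianOn G U) (hu : u ∈ U) {v w : F} (h : ∀ z, G u v z = G u w z) :
    v = w := by
  by_contra hne
  have h1 := hG.pos u hu (v - w) (sub_ne_zero.2 hne)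
  have h2 := h (v - w)
  have h3 : G u (v - w) (v - w) = G u v (v - w) - G u w (v - w) := by simp
  linarith

theorem isInvertible (hG : IsRiemannianOn G U) [FiniteDimensional ℝ F] (hu : u ∈ U) :
    (G u).IsInvertible := by
  have hinj : Function.Injective (G u : F →ₗ[ℝ] (F →L[ℝ] ℝ)) := fun v w h =>
    hG.ext hu fun z => DFunLike.congr_fun h z
  have hfin : Module.finrank ℝ F = Module.finrank ℝ (F →L[ℝ] ℝ) := by
    rw [← (LinearMap.toContinuousLinearMap (𝕜 := ℝ) (E := F) (F' := ℝ)).finrank_eq]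
    exact (Subspace.dual_finrank_eq (K := ℝ) (V := F)).symm
  refine ⟨(LinearEquiv.ofInjectiveOfFinrankEq (G u : F →ₗ[ℝ] (F →L[ℝ] ℝ)) hinj
    hfin).toContinuousLinearEquiv, ?_⟩
  ext v w
  rfl

theorem fderiv_symm (hG : IsRiemannianOn G U) (hu : u ∈ U) (x v w : F) :
    fderiv ℝ G u x v w = fderiv ℝ G u x w v := by
  rw [← fderiv_clm_apply_const₂ (hG.differentiableAt hu),
    ← fderiv_clm_apply_const₂ (hG.differentiableAt hu)]
  have : (fun u' => G u' v w) =ᶠ[𝓝 u] fun u' => G u' w v := by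
    filter_upwards [hG.isOpen.mem_nhds hu] with u' hu'
    exact hG.symm u' hu' v w
  rw [this.fderiv_eq]

theorem curvature_swap (x y z : F) : curvature G u x y z = -curvature G u y x z := by
  rw [curvature, curvature, neg_sub]

theorem curvature_self (x z : F) : curvature G u x x z = 0 := by
  rw [curvature, sub_self]

variable [FiniteDimensional ℝ F]

theorem apply_christoffel (hG : IsRiemannianOn G U) (hu : u ∈ U) (v w z : F) :
    G u (christoffel G u v w) z = (1 / 2) * christoffelLower G u v w z := by
  obtain ⟨e, he⟩ := hG.isInvertible hu
  rw [christoffel_apply, ← he, ContinuousLinearMap.inverse_equiv]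
  simp

theorem christoffel_symm (hG : IsRiemannianOn G U) (hu : u ∈ U) (v w : F) :
    christoffel G u v w = christoffel G u w v := by
  refine hG.ext hu fun z => ?_
  rw [hG.apply_christoffel hu, hG.apply_christoffel hu, christoffelLower_apply,
    christoffelLower_apply, hG.fderiv_symm hu z v w]
  ring

theorem fderiv_eq (hG : IsRiemannianOn G U) (hu : u ∈ U) (x v w : F) :
    fderiv ℝ G u x v w = G u (christoffel G u x v) w + G u v (christoffel G u x w) := by
  rw [hG.symm u hu v, hG.apply_christoffel hu, hG.apply_christoffel hu, christoffelLower_apply,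
    christoffelLower_apply, hG.fderiv_symm hu x w v, hG.fderiv_symm hu v x w,
    hG.fderiv_symm hu w x v]
  ring

/-- The Levi-Civita connection is the only torsion-free metric connection. -/
theorem christoffel_eq (hG : IsRiemannianOn G U) (hu : u ∈ U) {B : F → F → F}
    (hsymm : ∀ v w, B v w = B w v)
    (hB : ∀ x v w, fderiv ℝ G u x v w = G u (B x v) w + G u v (B x w)) (v w : F) :
    christoffel G u v w = B v w := by
  refine hG.ext hu fun z => ?_
  rw [hG.apply_christoffel hu, christoffelLower_apply, hB, hB, hB, hsymm w v, hsymm z v,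
    hsymm z w, hG.symm u hu w, hG.symm u hu v (B w z)]
  ring

theorem contDiffOn_christoffel (hG : IsRiemannianOn G U) : ContDiffOn ℝ ∞ (christoffel G) U := by
  have h1 : ContDiffOn ℝ ∞ (fun u => fderiv ℝ G u) U :=
    hG.contDiffOn.fderiv_of_isOpen hG.isOpen (by simp)
  have h2 : ContDiffOn ℝ ∞ (fun u => (G u).inverse) U := fun u hu =>
    ((hG.isInvertible hu).contDiffAt_map_inverse.comp u (hG.contDiffAt hu)).contDiffWithinAt
  rw [contDiffOn_clm_apply]
  intro v
  rw [contDiffOn_clm_apply]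
  intro w
  have h3 : ContDiffOn ℝ ∞ (fun u => christoffelLower G u v w) U := by
    rw [contDiffOn_clm_apply]
    intro z
    simp only [christoffelLower_apply]
    have h (a b c : F) : ContDiffOn ℝ ∞ (fun u => fderiv ℝ G u a b c) U :=
      ((h1.clm_apply contDiffOn_const).clm_apply contDiffOn_const).clm_apply contDiffOn_const
    exact ((h _ _ _).add (h _ _ _)).sub (h _ _ _)
  simp only [christoffel_apply]
  exact contDiffOn_const.smul (h2.clm_apply h3)

theorem contDiffAt_christoffel (hG : IsRiemannianOn G U) (hu : u ∈ U) : ContDiffAt ℝ ∞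
    (christoffel G) u :=
  hG.contDiffOn_christoffel.contDiffAt (hG.isOpen.mem_nhds hu)

theorem differentiableAt_christoffel (hG : IsRiemannianOn G U) (hu : u ∈ U) : DifferentiableAt ℝ
    (christoffel G) u :=
  (hG.contDiffAt_christoffel hu).differentiableAt (by simp)

theorem curvature_eq (hG : IsRiemannianOn G U) (hu : u ∈ U) (x y z : F) :
    curvature G u x y z = fderiv ℝ (christoffel G) u x y z - fderiv ℝ (christoffel G) u y x z
      + christoffel G u x (christoffel G u y z) - christoffel G u y (christoffel G u x z) := by
  rw [curvature, covDeriv, covDeriv, fderiv_clm_apply_const₂ (hG.differentiableAt_christoffel hu),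
    fderiv_clm_apply_const₂ (hG.differentiableAt_christoffel hu)]
  abel

theorem fderiv_christoffel_symm (hG : IsRiemannianOn G U) (hu : u ∈ U) (x v w : F) :
    fderiv ℝ (christoffel G) u x v w = fderiv ℝ (christoffel G) u x w v := by
  rw [← fderiv_clm_apply_const₂ (hG.differentiableAt_christoffel hu),
    ← fderiv_clm_apply_const₂ (hG.differentiableAt_christoffel hu)]
  have : (fun u' => christoffel G u' v w) =ᶠ[𝓝 u] fun u' => christoffel G u' w v := by
    filter_upwards [hG.isOpen.mem_nhds hu] with u' hu'
    exact hG.christoffel_symm hu' v w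
  rw [this.fderiv_eq]

theorem curvature_bianchi (hG : IsRiemannianOn G U) (hu : u ∈ U) (x y z : F) :
    curvature G u x y z + curvature G u y z x + curvature G u z x y = 0 := by
  rw [hG.curvature_eq hu, hG.curvature_eq hu, hG.curvature_eq hu, hG.fderiv_christoffel_symm hu y x,
    hG.fderiv_christoffel_symm hu z y, hG.fderiv_christoffel_symm hu x z,
    hG.christoffel_symm hu y x, hG.christoffel_symm hu z y, hG.christoffel_symm hu x z]
  abel

theorem fderiv_fderiv_eq (hG : IsRiemannianOn G U) (hu : u ∈ U) (x y z w : F) :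
    fderiv ℝ (fderiv ℝ G) u x y z w =
      fderiv ℝ G u x (christoffel G u y z) w + G u (fderiv ℝ (christoffel G) u x y z) w
      + (fderiv ℝ G u x z (christoffel G u y w) + G u z (fderiv ℝ (christoffel G) u x y w)) := by
  have hD : DifferentiableAt ℝ (fderiv ℝ G) u :=
    ((hG.contDiffAt hu).fderiv_right (m := ∞) (by simp)).differentiableAt (by simp)
  have h1 := hasFDerivAt_clm_apply_const hD y
  have h2 := fderiv_clm_apply_const₂ h1.differentiableAt z w x
  rw [h1.fderiv] at h2
  have h3 : (fun u' => fderiv ℝ G u' y z w) =ᶠ[𝓝 u] fun u' =>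
      G u' (christoffel G u' y z) w + G u' z (christoffel G u' y w) := by
    filter_upwards [hG.isOpen.mem_nhds hu] with u' hu'
    exact hG.fderiv_eq hu' y z w
  rw [h3.fderiv_eq] at h2
  have hΓ := (hG.differentiableAt_christoffel hu).hasFDerivAt
  have hG' := (hG.differentiableAt hu).hasFDerivAt
  have c (v : F) := hasFDerivAt_const (𝕜 := ℝ) v u
  have h4 := ((hG'.clm_apply ((hΓ.clm_apply (c y)).clm_apply (c z))).clm_apply (c w)).add
    ((hG'.clm_apply (c z)).clm_apply ((hΓ.clm_apply (c y)).clm_apply (c w)))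
  have h5 := h4.fderiv
  rw [show (fun u' => G u' (christoffel G u' y z) w + G u' z (christoffel G u' y w)) =
    ((fun u' => G u' (christoffel G u' y z) w) + fun u' => G u' z (christoffel G u' y w)) from rfl,
    h5] at h2
  simp at h2
  rw [← h2]
  ring

theorem curvature_skew (hG : IsRiemannianOn G U) (hu : u ∈ U) (x y z w : F) :
    G u (curvature G u x y z) w = -G u z (curvature G u x y w) := by
  have h1 := hG.fderiv_fderiv_eq hu x y z w
  have h2 := hG.fderiv_fderiv_eq hu y x z w
  have h3 : fderiv ℝ (fderiv ℝ G) u x y = fderiv ℝ (fderiv ℝ G) u y x :=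
    ((hG.contDiffAt hu).isSymmSndFDerivAt (by simpa using ENat.LEInfty.out)) x y
  rw [h3, h2] at h1
  simp only [hG.fderiv_eq hu] at h1
  rw [hG.curvature_eq hu, hG.curvature_eq hu]
  simp only [map_add, map_sub, add_apply, sub_apply]
  linarith

theorem curvature_pair_symm (hG : IsRiemannianOn G U) (hu : u ∈ U) (x y z w : F) :
    G u (curvature G u x y z) w = G u (curvature G u z w x) y := by
  have sk := hG.curvature_skew hu
  have sw (x y z w : F) : G u (curvature G u x y z) w = -G u (curvature G u y x z) w := by
    rw [curvature_swap x y]; simp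
  have sk' (x y z w : F) : G u (curvature G u x y z) w = - G u (curvature G u x y w) z := by
    rw [sk, hG.symm u hu]
  have bi (x y z w : F) : G u (curvature G u x y z) w + G u (curvature G u y z x) w
      + G u (curvature G u z x y) w = 0 := by
    have := congrArg (fun v => G u v w) (hG.curvature_bianchi hu x y z)
    simpa using this
  have b1 := bi x y z w
  have b2 := bi y z w x
  have b3 := bi z w x y
  have b4 := bi w x y z
  have e1 := sk' y z w x
  have e2 := sk' z x y w
  have e2' := sw z x w y
  have e3 := sk' z w y x
  have e4 := sk' w y z x
  have e4' := sw w y x z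
  have e5 := sk' w x z y
  have e6 := sk' x y w z
  have e7 := sk' x z w y
  have e8 := sk' y w x z
  linarith

theorem curvature_add_left (hG : IsRiemannianOn G U) (hu : u ∈ U) (x x' y z : F) :
    curvature G u (x + x') y z = curvature G u x y z + curvature G u x' y z := by
  simp only [hG.curvature_eq hu, map_add, add_apply]
  abel

theorem curvature_smul_left (hG : IsRiemannianOn G U) (hu : u ∈ U) (c : ℝ) (x y z : F) :
    curvature G u (c • x) y z = c • curvature G u x y z := by
  simp only [hG.curvature_eq hu, map_smul, smul_apply]
  module

theorem curvature_smul_right (hG : IsRiemannianOn G U) (hu : u ∈ U) (c : ℝ) (x y z : F) :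
    curvature G u x y (c • z) = c • curvature G u x y z := by
  simp only [hG.curvature_eq hu, map_smul]
  module

end IsRiemannianOn

end CoordinateMetric

/-! ### Connections related by a field of linear maps -/

section Naturality

variable {F E : Type*} [NormedAddCommGroup F] [NormedSpace ℝ F] [NormedAddCommGroup E]
  [NormedSpace ℝ E]

/-- If a field of linear maps `P` intertwines the connection `Γ` on the tangent spaces with the
connection `A` on the trivial bundle with fibre `E`, then it intertwines their curvatures. -/
theorem map_curvature_of_intertwines {Γ : F → F →L[ℝ] F →L[ℝ] F} {P : F → F →L[ℝ] E}
    {A : F → F →L[ℝ] E →L[ℝ] E} {u : F} (hΓ : DifferentiableAt ℝ Γ u) (hP : ContDiffAt ℝ ∞ P u)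
    (hA : DifferentiableAt ℝ A u)
    (h : ∀ᶠ u' in 𝓝 u, ∀ ξ η, P u' (Γ u' ξ η) = fderiv ℝ P u' ξ η + A u' ξ (P u' η))
    (ξ η ζ : F) :
    P u (fderiv ℝ Γ u ξ η ζ - fderiv ℝ Γ u η ξ ζ + Γ u ξ (Γ u η ζ) - Γ u η (Γ u ξ ζ)) =
      fderiv ℝ A u ξ η (P u ζ) - fderiv ℝ A u η ξ (P u ζ) + A u ξ (A u η (P u ζ))
        - A u η (A u ξ (P u ζ)) := by
  have hP1 := (hP.differentiableAt (by simp)).hasFDerivAt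
  have hP2 := ((hP.fderiv_right (m := ∞) (by simp)).differentiableAt (by simp)).hasFDerivAt
  have c (v : F) := hasFDerivAt_const (𝕜 := ℝ) v u
  have key (ξ η : F) : fderiv ℝ P u ξ (Γ u η ζ) + P u (fderiv ℝ Γ u ξ η ζ) =
      fderiv ℝ (fderiv ℝ P) u ξ η ζ + fderiv ℝ A u ξ η (P u ζ) + A u η (fderiv ℝ P u ξ ζ) := by
    have h1 := hP1.clm_apply ((hΓ.hasFDerivAt.clm_apply (c η)).clm_apply (c ζ))
    have h2 := ((hP2.clm_apply (c η)).clm_apply (c ζ)).add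
      ((hA.hasFDerivAt.clm_apply (c η)).clm_apply (hP1.clm_apply (c ζ)))
    have h3 : (fun u' => P u' (Γ u' η ζ)) =ᶠ[𝓝 u]
        ((fun u' => fderiv ℝ P u' η ζ) + fun u' => A u' η (P u' ζ)) := by
      filter_upwards [h] with u' hu'
      exact hu' η ζ
    have h4 := DFunLike.congr_fun (h1.unique (h2.congr_of_eventuallyEq h3)) ξ
    simp at h4
    rw [add_comm, h4]
    abel
  have hsymm : fderiv ℝ (fderiv ℝ P) u ξ η = fderiv ℝ (fderiv ℝ P) u η ξ :=
    (hP.isSymmSndFDerivAt (by simpa using ENat.LEInfty.out)) ξ η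
  have h0 := h.self_of_nhds
  have k1 := key ξ η
  have k2 := key η ξ
  rw [← hsymm] at k2
  simp only [map_sub, map_add, h0]
  rw [eq_sub_of_add_eq' k1, eq_sub_of_add_eq' k2]
  abel

end Naturality

section ChangeOfCoordinates

variable {F : Type*} [NormedAddCommGroup F] [NormedSpace ℝ F] [FiniteDimensional ℝ F]
  {G G' : F → F →L[ℝ] F →L[ℝ] ℝ} {U U' : Set F} {f : F → F} {u : F}

namespace IsRiemannianOn

/-- The transformation law of the Christoffel symbols. -/
theorem fderiv_christoffel_of_isometry (hG : IsRiemannianOn G U) (hG' : IsRiemannianOn G' U')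
    (hf : ContDiffAt ℝ ∞ f u) (hu : u ∈ U) (hu' : f u ∈ U') (hinv : (fderiv ℝ f u).IsInvertible)
    (h : ∀ᶠ w in 𝓝 u, ∀ a b, G w a b = G' (f w) (fderiv ℝ f w a) (fderiv ℝ f w b)) (a b : F) :
    fderiv ℝ f u (christoffel G u a b) =
      fderiv ℝ (fderiv ℝ f) u a b + christoffel G' (f u) (fderiv ℝ f u a) (fderiv ℝ f u b) := by
  obtain ⟨e, he⟩ := hinv
  have hf1 := (hf.differentiableAt (by simp)).hasFDerivAt
  have hf2 := ((hf.fderiv_right (m := ∞) (by simp)).differentiableAt (by simp)).hasFDerivAt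
  have hsymm (a b : F) : fderiv ℝ (fderiv ℝ f) u a b = fderiv ℝ (fderiv ℝ f) u b a :=
    (hf.isSymmSndFDerivAt (by simpa using ENat.LEInfty.out)) a b
  have key := hG.christoffel_eq hu
    (B := fun a b => e.symm (fderiv ℝ (fderiv ℝ f) u a b
      + christoffel G' (f u) (fderiv ℝ f u a) (fderiv ℝ f u b)))
    (fun v w => by rw [hsymm, hG'.christoffel_symm hu']) ?_ a b
  · rw [key, ← he]
    simp
  · intro x v w
    have c (v : F) := hasFDerivAt_const (𝕜 := ℝ) v u
    have h1 := (((hG'.differentiableAt hu').hasFDerivAt.comp u hf1).clm_apply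
      (hf2.clm_apply (c v))).clm_apply (hf2.clm_apply (c w))
    have h3 : (fun u' => G u' v w) =ᶠ[𝓝 u]
        fun u' => (G' ∘ f) u' (fderiv ℝ f u' v) (fderiv ℝ f u' w) := by
      filter_upwards [h] with u' hu'
      exact hu' v w
    rw [← fderiv_clm_apply_const₂ (hG.differentiableAt hu), h3.fderiv_eq, h1.fderiv,
      h.self_of_nhds, h.self_of_nhds]
    have e' (z : F) : fderiv ℝ f u (e.symm z) = z := by rw [← he]; simp
    rw [e', e']
    simp [hG'.fderiv_eq hu']
    ring

/-- The Riemann tensor is natural under local isometries. -/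
theorem fderiv_curvature_of_isometry (hG : IsRiemannianOn G U) (hG' : IsRiemannianOn G' U')
    (hfe : ∀ᶠ w in 𝓝 u, ContDiffAt ℝ ∞ f w) (hu : u ∈ U) (hu' : f u ∈ U')
    (hinv : ∀ᶠ w in 𝓝 u, (fderiv ℝ f w).IsInvertible)
    (h : ∀ᶠ w in 𝓝 u, ∀ a b, G w a b = G' (f w) (fderiv ℝ f w a) (fderiv ℝ f w b)) (a b c : F) :
    fderiv ℝ f u (curvature G u a b c) =
      curvature G' (f u) (fderiv ℝ f u a) (fderiv ℝ f u b) (fderiv ℝ f u c) := by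
  have hf := hfe.self_of_nhds
  have hf1 := (hf.differentiableAt (by simp)).hasFDerivAt
  have hP : ContDiffAt ℝ ∞ (fderiv ℝ f) u := hf.fderiv_right (m := ∞) (by simp)
  have hf2 := (hP.differentiableAt (by simp)).hasFDerivAt
  have hΓ' := (hG'.differentiableAt_christoffel hu').hasFDerivAt
  have hA : HasFDerivAt (fun w => (christoffel G' (f w)).comp (fderiv ℝ f w)) _ u :=
    HasFDerivAt.clm_comp (hΓ'.comp u hf1) hf2
  have hsymm : fderiv ℝ (fderiv ℝ f) u a b = fderiv ℝ (fderiv ℝ f) u b a :=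
    (hf.isSymmSndFDerivAt (by simpa using ENat.LEInfty.out)) a b
  have key := map_curvature_of_intertwines (hG.differentiableAt_christoffel hu) hP
    hA.differentiableAt ?_ a b c
  · rw [← hG.curvature_eq hu] at key
    rw [key, hG'.curvature_eq hu', hA.fderiv]
    simp [hsymm]
  · filter_upwards [hinv, h.eventually_nhds, hG.isOpen.mem_nhds hu, hfe,
      hf1.continuousAt.preimage_mem_nhds (hG'.isOpen.mem_nhds hu')] with w h1 h2 h3 h4 h5 ξ η
    rw [fderiv_christoffel_of_isometry hG hG' h4 h3 h5 h1 h2]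
    rfl

end IsRiemannianOn

end ChangeOfCoordinates

/-! ### The Sasaki metric in coordinates -/

section SasakiCoordinates

variable {E : Type*} [NormedAddCommGroup E] [NormedSpace ℝ E]
  (G : E → E →L[ℝ] E →L[ℝ] ℝ)

/-- The connection map `(a, b) ↦ b + Γ(v, a)` at `(u, v)`. -/
def connector (p : E × E) : E × E →L[ℝ] E :=
  ContinuousLinearMap.snd ℝ E E
    + (christoffel G p.1 p.2).comp (ContinuousLinearMap.fst ℝ E E)

theorem connector_apply (p ξ : E × E) : connector G p ξ = ξ.2 + christoffel G p.1 p.2 ξ.1 := rfl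

/-- The Sasaki metric of the coordinate metric `G`. -/
def sasakiCoord (p : E × E) : E × E →L[ℝ] E × E →L[ℝ] ℝ :=
  (G p.1).bilinearComp (ContinuousLinearMap.fst ℝ E E) (ContinuousLinearMap.fst ℝ E E)
    + (G p.1).bilinearComp (connector G p) (connector G p)

theorem sasakiCoord_apply (p ξ η : E × E) :
    sasakiCoord G p ξ η = G p.1 ξ.1 η.1 + G p.1 (connector G p ξ) (connector G p η) := rfl

variable {G} {U : Set E} [FiniteDimensional ℝ E]

namespace IsRiemannianOn

theorem contDiffOn_connector (hG : IsRiemannianOn G U) : ContDiffOn ℝ ∞ (connector G)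
    (U ×ˢ Set.univ) := by
  rw [contDiffOn_clm_apply]
  intro ξ
  simp only [connector_apply]
  have h : ContDiffOn ℝ ∞ (fun p : E × E => christoffel G p.1) (U ×ˢ Set.univ) :=
    hG.contDiffOn_christoffel.comp contDiffOn_fst fun p hp => hp.1
  exact contDiffOn_const.add ((h.clm_apply contDiffOn_snd).clm_apply contDiffOn_const)

theorem sasakiCoord (hG : IsRiemannianOn G U) : IsRiemannianOn (sasakiCoord G) (U ×ˢ Set.univ) where
  isOpen := hG.isOpen.prod isOpen_univ
  contDiffOn := by
    rw [contDiffOn_clm_apply]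
    intro ξ
    rw [contDiffOn_clm_apply]
    intro η
    simp only [sasakiCoord_apply]
    have h : ContDiffOn ℝ ∞ (fun p : E × E => G p.1) (U ×ˢ Set.univ) :=
      hG.contDiffOn.comp contDiffOn_fst fun p hp => hp.1
    have hK (ξ : E × E) : ContDiffOn ℝ ∞ (fun p => connector G p ξ) (U ×ˢ Set.univ) :=
      hG.contDiffOn_connector.clm_apply contDiffOn_const
    exact ((h.clm_apply contDiffOn_const).clm_apply contDiffOn_const).add
      ((h.clm_apply (hK ξ)).clm_apply (hK η))
  symm p hp ξ η := by
    rw [sasakiCoord_apply, sasakiCoord_apply, hG.symm _ hp.1, hG.symm _ hp.1 (connector G p ξ)]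
  pos p hp ξ hξ := by
    have nn (v : E) : 0 ≤ G p.1 v v := by
      rcases eq_or_ne v 0 with rfl | hv
      · simp
      · exact (hG.pos _ hp.1 v hv).le
    rw [sasakiCoord_apply]
    by_cases h1 : ξ.1 = 0
    · have h2 : ξ.2 ≠ 0 := fun h2 => hξ (Prod.ext h1 h2)
      have : connector G p ξ = ξ.2 := by simp [connector_apply, h1]
      rw [this]
      exact add_pos_of_nonneg_of_pos (nn _) (hG.pos _ hp.1 _ h2)
    · exact add_pos_of_pos_of_nonneg (hG.pos _ hp.1 _ h1) (nn _)

theorem hasFDerivAt_connector_apply (hG : IsRiemannianOn G U) {p : E × E} (hp : p.1 ∈ U)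
    (η : E × E) :
    ∃ L : E × E →L[ℝ] E, HasFDerivAt (fun q => connector G q η) L p ∧ ∀ ξ : E × E, L ξ =
      fderiv ℝ (christoffel G) p.1 ξ.1 p.2 η.1 + christoffel G p.1 ξ.2 η.1 := by
  have h := (((hG.differentiableAt_christoffel hp).hasFDerivAt.comp p hasFDerivAt_fst).clm_apply
    (hasFDerivAt_snd (𝕜 := ℝ) (p := p))).clm_apply (hasFDerivAt_const (𝕜 := ℝ) η.1 p)
  refine ⟨_, h.const_add η.2, fun ξ => ?_⟩
  simp
  abel

theorem fderiv_connector_apply (hG : IsRiemannianOn G U) {p : E × E} (hp : p.1 ∈ U) (ξ η : E × E) :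
    fderiv ℝ (connector G) p ξ η =
      fderiv ℝ (christoffel G) p.1 ξ.1 p.2 η.1 + christoffel G p.1 ξ.2 η.1 := by
  obtain ⟨L, hL, hL'⟩ := hG.hasFDerivAt_connector_apply hp η
  have hd : DifferentiableAt ℝ (connector G) p :=
    (hG.contDiffOn_connector.contDiffAt ((hG.isOpen.prod isOpen_univ).mem_nhds
      ⟨hp, Set.mem_univ _⟩)).differentiableAt (by simp)
  rw [← hL', ← (hasFDerivAt_clm_apply_const hd η).unique hL]
  rfl

end IsRiemannianOn

end SasakiCoordinates

section SasakiConnection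

variable {E : Type*} [NormedAddCommGroup E] [NormedSpace ℝ E] (G : E → E →L[ℝ] E →L[ℝ] ℝ)

/-- The horizontal part of `∇_ξ η` in the Sasaki metric, for constant fields `ξ`, `η`. -/
def sasakiHor (p ξ η : E × E) : E :=
  christoffel G p.1 ξ.1 η.1 + (1 / 2 : ℝ) • curvature G p.1 p.2 (connector G p ξ) η.1
    + (1 / 2 : ℝ) • curvature G p.1 p.2 (connector G p η) ξ.1

/-- The vertical part of `∇_ξ η` in the Sasaki metric, for constant fields `ξ`, `η`. -/
def sasakiVert (p ξ η : E × E) : E :=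
  fderiv ℝ (christoffel G) p.1 ξ.1 p.2 η.1 + christoffel G p.1 ξ.2 η.1
    + christoffel G p.1 ξ.1 (connector G p η) - (1 / 2 : ℝ) • curvature G p.1 ξ.1 η.1 p.2

/-- The Christoffel symbols of the Sasaki metric. -/
def sasakiChristoffel (p ξ η : E × E) : E × E :=
  (sasakiHor G p ξ η, sasakiVert G p ξ η - christoffel G p.1 p.2 (sasakiHor G p ξ η))

theorem connector_sasakiChristoffel (p ξ η : E × E) :
    connector G p (sasakiChristoffel G p ξ η) = sasakiVert G p ξ η := by
  simp [connector_apply, sasakiChristoffel]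

variable {G} {U : Set E} [FiniteDimensional ℝ E]

namespace IsRiemannianOn

theorem sasakiHor_symm (p ξ η : E × E) (hG : IsRiemannianOn G U) (hp : p.1 ∈ U) :
    sasakiHor G p ξ η = sasakiHor G p η ξ := by
  rw [sasakiHor, sasakiHor, hG.christoffel_symm hp ξ.1]
  abel

theorem sasakiVert_symm (p ξ η : E × E) (hG : IsRiemannianOn G U) (hp : p.1 ∈ U) :
    sasakiVert G p ξ η = sasakiVert G p η ξ := by
  rw [sasakiVert, sasakiVert, hG.curvature_eq hp, hG.curvature_eq hp, connector_apply,
    connector_apply, hG.fderiv_christoffel_symm hp ξ.1 p.2, hG.fderiv_christoffel_symm hp η.1 p.2,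
    hG.christoffel_symm hp p.2 ξ.1, hG.christoffel_symm hp p.2 η.1, map_add, map_add,
    hG.christoffel_symm hp ξ.1 η.2, hG.christoffel_symm hp η.1 ξ.2]
  module

theorem fderiv_sasakiCoord (hG : IsRiemannianOn G U) (p ξ η ζ : E × E) (hp : p.1 ∈ U) :
    fderiv ℝ (SasakiLift.sasakiCoord G) p ξ η ζ =
      fderiv ℝ G p.1 ξ.1 η.1 ζ.1 + fderiv ℝ G p.1 ξ.1 (connector G p η) (connector G p ζ)
      + G p.1 (fderiv ℝ (connector G) p ξ η) (connector G p ζ)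
      + G p.1 (connector G p η) (fderiv ℝ (connector G) p ξ ζ) := by
  rw [← fderiv_clm_apply_const₂ (hG.sasakiCoord.differentiableAt ⟨hp, Set.mem_univ _⟩)]
  have hd : DifferentiableAt ℝ (connector G) p :=
    (hG.contDiffOn_connector.contDiffAt ((hG.isOpen.prod isOpen_univ).mem_nhds
      ⟨hp, Set.mem_univ _⟩)).differentiableAt (by simp)
  have hg := (hG.differentiableAt hp).hasFDerivAt.comp p hasFDerivAt_fst
  have c (v : E) := hasFDerivAt_const (𝕜 := ℝ) v p
  have h := ((hg.clm_apply (c η.1)).clm_apply (c ζ.1)).add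
    ((hg.clm_apply (hasFDerivAt_clm_apply_const hd η)).clm_apply (hasFDerivAt_clm_apply_const hd ζ))
  have h' : HasFDerivAt (fun q => SasakiLift.sasakiCoord G q η ζ) _ p := h
  rw [h'.fderiv]
  simp
  ring

/-- The Levi-Civita connection of the Sasaki metric. -/
theorem christoffel_sasakiCoord (hG : IsRiemannianOn G U) {p : E × E} (hp : p.1 ∈ U)
    (ξ η : E × E) :
    christoffel (SasakiLift.sasakiCoord G) p ξ η = sasakiChristoffel G p ξ η := by
  refine hG.sasakiCoord.christoffel_eq ⟨hp, Set.mem_univ _⟩ (fun v w => ?_) (fun ξ η ζ => ?_) ξ η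
  · rw [sasakiChristoffel, sasakiChristoffel, hG.sasakiHor_symm _ _ _ hp,
      hG.sasakiVert_symm _ _ _ hp]
  · rw [hG.fderiv_sasakiCoord _ _ _ _ hp, sasakiCoord_apply, sasakiCoord_apply,
      connector_sasakiChristoffel, connector_sasakiChristoffel, hG.fderiv_connector_apply hp,
      hG.fderiv_connector_apply hp, hG.fderiv_eq hp, hG.fderiv_eq hp]
    simp only [sasakiChristoffel, sasakiHor, sasakiVert, map_add, map_sub, map_smul, add_apply,
      sub_apply, smul_apply, smul_eq_mul]
    have h1 := hG.curvature_skew hp p.2 (connector G p ξ) η.1 ζ.1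
    have h2 := hG.curvature_pair_symm hp p.2 (connector G p η) ξ.1 ζ.1
    have h3 := hG.curvature_pair_symm hp p.2 (connector G p ζ) ξ.1 η.1
    have h4 := hG.symm _ hp (curvature G p.1 ξ.1 ζ.1 p.2) (connector G p η)
    have h5 := hG.symm _ hp (curvature G p.1 p.2 (connector G p ζ) ξ.1) η.1
    linarith

/-! #### The flat case -/

theorem curvature_sasakiCoord_eq_zero (hG : IsRiemannianOn G U)
    (hflat : ∀ u ∈ U, ∀ x y z, curvature G u x y z = 0) {p : E × E} (hp : p.1 ∈ U)
    (ξ η ζ : E × E) : curvature (SasakiLift.sasakiCoord G) p ξ η ζ = 0 := by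
  have hmem : p ∈ U ×ˢ (Set.univ : Set E) := ⟨hp, Set.mem_univ _⟩
  have hnhds := (hG.isOpen.prod isOpen_univ).mem_nhds hmem
  have hΓ := (hG.differentiableAt_christoffel hp).hasFDerivAt
  have hA : HasFDerivAt (fun q : E × E =>
      (christoffel G q.1).comp (ContinuousLinearMap.fst ℝ E E)) _ p :=
    HasFDerivAt.clm_comp (hΓ.comp p hasFDerivAt_fst) (hasFDerivAt_const _ p)
  have h1 := map_curvature_of_intertwines (hG.sasakiCoord.differentiableAt_christoffel hmem)
    (P := fun _ => ContinuousLinearMap.fst ℝ E E) contDiffAt_const hA.differentiableAt (by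
      filter_upwards [hnhds] with q hq ξ η
      rw [hG.christoffel_sasakiCoord hq.1]
      simp [sasakiChristoffel, sasakiHor, hflat q.1 hq.1]) ξ η ζ
  have h2 := map_curvature_of_intertwines (hG.sasakiCoord.differentiableAt_christoffel hmem)
    (P := connector G) (hG.contDiffOn_connector.contDiffAt hnhds) hA.differentiableAt (by
      filter_upwards [hnhds] with q hq ξ η
      rw [hG.christoffel_sasakiCoord hq.1, connector_sasakiChristoffel,
        hG.fderiv_connector_apply hq.1, sasakiVert, hflat q.1 hq.1]
      simp) ξ η ζ
  rw [← hG.sasakiCoord.curvature_eq hmem, hA.fderiv] at h1 h2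
  have h3 (z : E) : fderiv ℝ (christoffel G) p.1 ξ.1 η.1 z - fderiv ℝ (christoffel G) p.1 η.1 ξ.1 z
      + christoffel G p.1 ξ.1 (christoffel G p.1 η.1 z)
      - christoffel G p.1 η.1 (christoffel G p.1 ξ.1 z) = 0 := by
    rw [← hG.curvature_eq hp, hflat _ hp]
  have h1' : (curvature (SasakiLift.sasakiCoord G) p ξ η ζ).1 = 0 := by
    simpa [h3] using h1
  have h2' : connector G p (curvature (SasakiLift.sasakiCoord G) p ξ η ζ) = 0 := by
    simpa [h3] using h2
  refine Prod.ext h1' ?_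
  simpa [connector_apply, h1'] using h2'

/-! #### Curvature components with vertical arguments -/

theorem christoffel_sasakiCoord_vert (hG : IsRiemannianOn G U) {p : E × E} (hp : p.1 ∈ U)
    (ξ : E × E) (Z : E) :
    christoffel (SasakiLift.sasakiCoord G) p ξ (0, Z) =
      ((1 / 2 : ℝ) • curvature G p.1 p.2 Z ξ.1, christoffel G p.1 ξ.1 Z
        - christoffel G p.1 p.2 ((1 / 2 : ℝ) • curvature G p.1 p.2 Z ξ.1)) := by
  have h0 (x y : E) : curvature G p.1 x y 0 = 0 := by simp [hG.curvature_eq hp]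
  have h0' (x z : E) : curvature G p.1 x 0 z = 0 := by simp [hG.curvature_eq hp]
  rw [hG.christoffel_sasakiCoord hp]
  simp [sasakiChristoffel, sasakiHor, sasakiVert, connector_apply, h0, h0']

theorem christoffel_sasakiCoord_vert_vert (hG : IsRiemannianOn G U) {p : E × E} (hp : p.1 ∈ U)
    (Y Z : E) : christoffel (SasakiLift.sasakiCoord G) p (0, Y) (0, Z) = 0 := by
  have h0 (x y : E) : curvature G p.1 x y 0 = 0 := by simp [hG.curvature_eq hp]
  rw [hG.christoffel_sasakiCoord_vert hp]
  simp [h0]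

/-- Vertical derivatives of the Christoffel symbols of the Sasaki metric, horizontal part. -/
theorem fst_fderiv_christoffel_sasakiCoord (hG : IsRiemannianOn G U) {p : E × E} (hp : p.1 ∈ U)
    (Y Z : E) (ξ : E × E) :
    (fderiv ℝ (fun q => christoffel (SasakiLift.sasakiCoord G) q ξ (0, Z)) p (0, Y)).1 =
      (1 / 2 : ℝ) • curvature G p.1 Y Z ξ.1 := by
  have hd := hG.sasakiCoord.differentiableAt_christoffel (u := p) ⟨hp, Set.mem_univ _⟩
  have hd' := (hasFDerivAt_clm_apply_const (hasFDerivAt_clm_apply_const hd ξ).differentiableAt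
    ((0, Z) : E × E)).differentiableAt
  have h1 := (hd'.hasFDerivAt.fst).comp_hasDerivAt_of_eq (0 : ℝ)
    (f := fun t : ℝ => p + t • ((0, Y) : E × E)) (f' := (0, Y))
    (by simpa using ((hasDerivAt_id (0 : ℝ)).smul_const ((0, Y) : E × E)).const_add p) (by simp)
  have h2 : HasDerivAt (fun t : ℝ => (1 / 2 : ℝ) • (curvature G p.1 p.2 Z ξ.1
      + t • curvature G p.1 Y Z ξ.1)) ((1 / 2 : ℝ) • curvature G p.1 Y Z ξ.1) 0 := by
    have h := (((hasDerivAt_id (0 : ℝ)).smul_const (curvature G p.1 Y Z ξ.1)).const_add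
      (curvature G p.1 p.2 Z ξ.1)).const_smul (1 / 2 : ℝ)
    rw [one_smul] at h
    exact h
  refine (h1.unique (h2.congr_of_eventuallyEq (Eventually.of_forall fun t => ?_)))
  have h3 : (p + t • ((0, Y) : E × E)).1 = p.1 := by simp
  have h4 : (p + t • ((0, Y) : E × E)).2 = p.2 + t • Y := by simp
  change (christoffel (SasakiLift.sasakiCoord G) (p + t • ((0, Y) : E × E)) ξ (0, Z)).1 = _
  rw [hG.christoffel_sasakiCoord_vert (by rwa [h3]), h3, h4, hG.curvature_add_left hp,
    hG.curvature_smul_left hp]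

theorem curvature_sasakiCoord_vvv (hG : IsRiemannianOn G U) {p : E × E} (hp : p.1 ∈ U)
    (X Y Z : E) : curvature (SasakiLift.sasakiCoord G) p (0, X) (0, Y) (0, Z) = 0 := by
  have h (Y : E) : (fun q => christoffel (SasakiLift.sasakiCoord G) q (0, Y) (0, Z)) =ᶠ[𝓝 p]
      fun _ => 0 := by
    filter_upwards [(hG.isOpen.prod isOpen_univ).mem_nhds
      (show p ∈ U ×ˢ (Set.univ : Set E) from ⟨hp, Set.mem_univ _⟩)] with q hq
    exact hG.christoffel_sasakiCoord_vert_vert hq.1 Y Z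
  rw [curvature, covDeriv, covDeriv, (h X).fderiv_eq, (h Y).fderiv_eq,
    hG.christoffel_sasakiCoord_vert_vert hp, hG.christoffel_sasakiCoord_vert_vert hp]
  simp

theorem fst_curvature_sasakiCoord_hvv (hG : IsRiemannianOn G U) {p : E × E} (hp : p.1 ∈ U)
    (ξ : E × E) (Y Z : E) : (curvature (SasakiLift.sasakiCoord G) p ξ (0, Y) (0, Z)).1 =
      -((1 / 2 : ℝ) • curvature G p.1 Y Z ξ.1)
        - (1 / 4 : ℝ) • curvature G p.1 p.2 Y (curvature G p.1 p.2 Z ξ.1) := by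
  have h : (fun q => christoffel (SasakiLift.sasakiCoord G) q (0, Y) (0, Z)) =ᶠ[𝓝 p]
      fun _ => 0 := by
    filter_upwards [(hG.isOpen.prod isOpen_univ).mem_nhds
      (show p ∈ U ×ˢ (Set.univ : Set E) from ⟨hp, Set.mem_univ _⟩)] with q hq
    exact hG.christoffel_sasakiCoord_vert_vert hq.1 Y Z
  rw [curvature, covDeriv, covDeriv, h.fderiv_eq, hG.christoffel_sasakiCoord_vert_vert hp,
    Prod.fst_sub, Prod.fst_add, Prod.fst_add, hG.fst_fderiv_christoffel_sasakiCoord hp,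
    hG.sasakiCoord.christoffel_symm ⟨hp, Set.mem_univ _⟩ (0, Y),
    hG.christoffel_sasakiCoord_vert hp, hG.christoffel_sasakiCoord_vert hp]
  simp only [hG.curvature_smul_right hp]
  simp
  module

theorem fst_curvature_sasakiCoord_vvh (hG : IsRiemannianOn G U) {p : E × E} (hp : p.1 ∈ U)
    (ξ : E × E) (X Y : E) : (curvature (SasakiLift.sasakiCoord G) p (0, X) (0, Y) ξ).1 =
      curvature G p.1 X Y ξ.1
        + (1 / 4 : ℝ) • (curvature G p.1 p.2 X (curvature G p.1 p.2 Y ξ.1)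
          - curvature G p.1 p.2 Y (curvature G p.1 p.2 X ξ.1)) := by
  have h (Y : E) : (fun q => christoffel (SasakiLift.sasakiCoord G) q (0, Y) ξ) =ᶠ[𝓝 p]
      fun q => christoffel (SasakiLift.sasakiCoord G) q ξ (0, Y) := by
    filter_upwards [(hG.isOpen.prod isOpen_univ).mem_nhds
      (show p ∈ U ×ˢ (Set.univ : Set E) from ⟨hp, Set.mem_univ _⟩)] with q hq
    exact hG.sasakiCoord.christoffel_symm hq (0, Y) ξ
  have hs := hG.sasakiCoord.christoffel_symm (u := p) ⟨hp, Set.mem_univ _⟩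
  rw [curvature, covDeriv, covDeriv, (h X).fderiv_eq, (h Y).fderiv_eq,
    Prod.fst_sub, Prod.fst_add, Prod.fst_add, hG.fst_fderiv_christoffel_sasakiCoord hp,
    hG.fst_fderiv_christoffel_sasakiCoord hp, hs (0, X), hs (0, Y), hs (0, X), hs (0, Y),
    hG.christoffel_sasakiCoord_vert hp, hG.christoffel_sasakiCoord_vert hp,
    hG.christoffel_sasakiCoord_vert hp, hG.christoffel_sasakiCoord_vert hp, curvature_swap Y X]
  simp only [hG.curvature_smul_right hp]
  module

/-- If the Sasaki metric satisfies the equation of weak symmetry at `p = (u, v)`, with some linear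
forms `α₁`, `α₂`, some bilinear form `B` and some vector `s`, then `R(v, Y) = 0` at `u` for all
`Y`. -/
theorem curvature_eq_zero_of_weaklySymmetric (hG : IsRiemannianOn G U) {p : E × E} (hp : p.1 ∈ U)
    (α₁ α₂ : E × E →L[ℝ] ℝ) (B : E × E →L[ℝ] E × E →L[ℝ] ℝ) (s : E × E)
    (h : ∀ W X Y Z : E × E, covDerivCurvature (SasakiLift.sasakiCoord G) p W X Y Z =
      α₁ W • curvature (SasakiLift.sasakiCoord G) p X Y Z
        + α₂ X • curvature (SasakiLift.sasakiCoord G) p W Y Z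
        + α₂ Y • curvature (SasakiLift.sasakiCoord G) p X W Z
        + α₂ Z • curvature (SasakiLift.sasakiCoord G) p X Y W
        + B (curvature (SasakiLift.sasakiCoord G) p X Y Z) W • s)
    (Y w : E) : curvature G p.1 p.2 Y w = 0 := by
  have key (Y w : E) : (α₂ (0, p.2) - 3) • curvature G p.1 p.2 Y (curvature G p.1 p.2 Y w) =
      (6 * α₂ (0, Y)) • curvature G p.1 p.2 Y w := by
    have h1 := congrArg Prod.fst (h (w, 0) (0, p.2) (0, Y) (0, Y))
    have h2 : (fun q => curvature (SasakiLift.sasakiCoord G) q (0, p.2) (0, Y) (0, Y)) =ᶠ[𝓝 p]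
        fun _ => 0 := by
      filter_upwards [(hG.isOpen.prod isOpen_univ).mem_nhds
        (show p ∈ U ×ˢ (Set.univ : Set E) from ⟨hp, Set.mem_univ _⟩)] with q hq
      exact hG.curvature_sasakiCoord_vvv hq.1 _ _ _
    rw [covDerivCurvature, covDeriv, h2.fderiv_eq, hG.curvature_sasakiCoord_vvv hp,
      hG.christoffel_sasakiCoord_vert hp, hG.christoffel_sasakiCoord_vert hp,
      curvature_swap (0, p.2) ((1 / 2 : ℝ) • _, _), curvature_swap (0, p.2) (w, 0)] at h1
    simp only [Prod.fst_sub, Prod.fst_add, Prod.smul_fst, Prod.fst_neg,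
      hG.fst_curvature_sasakiCoord_hvv hp, hG.fst_curvature_sasakiCoord_vvh hp,
      hG.curvature_smul_right hp, curvature_self] at h1
    have h0 (x y : E) : curvature G p.1 x y 0 = 0 := by simp [hG.curvature_eq hp]
    simp only [h0, fderiv_fun_const, Pi.zero_apply, zero_apply, map_zero, Prod.fst_zero, smul_zero,
      zero_smul, neg_zero, sub_zero, add_zero, zero_add, zero_sub] at h1
    linear_combination (norm := module) (4 : ℝ) • h1
  by_contra hne
  have hpos := hG.pos _ hp _ hne
  have h1 := congrArg (fun z => G p.1 z w) (key Y w)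
  have h2 : G p.1 (curvature G p.1 p.2 Y w) w = 0 := by
    have := hG.curvature_skew hp p.2 Y w w
    rw [hG.symm _ hp w] at this
    linarith
  have h3 := hG.curvature_skew hp p.2 Y (curvature G p.1 p.2 Y w) w
  simp only [map_smul, smul_apply, smul_eq_mul, h2, h3, mul_zero, mul_neg, neg_eq_zero,
    mul_eq_zero, hpos.ne', or_false] at h1
  have h4 := key Y w
  have h5 := key (Y + p.2) w
  have h6 (z : E) : curvature G p.1 p.2 (Y + p.2) z = curvature G p.1 p.2 Y z := by
    rw [curvature_swap, hG.curvature_add_left hp, curvature_self, add_zero, ← curvature_swap]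
  have h7 : α₂ (0, Y + p.2) = α₂ (0, Y) + α₂ (0, p.2) := by rw [← map_add]; simp
  rw [h6, h6, h1, zero_smul, eq_comm, smul_eq_zero, h7] at h5
  rw [h1, zero_smul, eq_comm, smul_eq_zero] at h4
  have h8 := h4.resolve_right hne
  have h9 := h5.resolve_right hne
  linarith

end IsRiemannianOn

end SasakiConnection

section Germs

variable {F : Type*} [NormedAddCommGroup F] [NormedSpace ℝ F]
  {G G' : F → F →L[ℝ] F →L[ℝ] ℝ} {u : F}

theorem christoffel_congr (h : G =ᶠ[𝓝 u] G') : christoffel G u = christoffel G' u := by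
  ext v w
  rw [christoffel_apply, christoffel_apply, h.self_of_nhds]
  congr 2
  ext z
  rw [christoffelLower_apply, christoffelLower_apply, h.fderiv_eq]

theorem curvature_congr (h : G =ᶠ[𝓝 u] G') : curvature G u = curvature G' u := by
  have h' : christoffel G =ᶠ[𝓝 u] christoffel G' :=
    h.eventuallyEq_nhds.mono fun _ => christoffel_congr
  have h2 (y z : F) : (fun u' => christoffel G u' y z) =ᶠ[𝓝 u] fun u' => christoffel G' u' y z :=
    h'.mono fun _ e => by simp only [e]
  funext x y z
  simp only [curvature, covDeriv, (h2 _ _).fderiv_eq, h'.self_of_nhds]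

theorem covDerivCurvature_congr (h : G =ᶠ[𝓝 u] G') :
    covDerivCurvature G u = covDerivCurvature G' u := by
  have h2 (x y z : F) : (fun u' => curvature G u' x y z) =ᶠ[𝓝 u] fun u' => curvature G' u' x y z :=
    h.eventuallyEq_nhds.mono fun _ e => by simp only [curvature_congr e]
  funext w x y z
  simp only [covDerivCurvature, covDeriv, (h2 _ _ _).fderiv_eq, curvature_congr h,
    christoffel_congr h]

theorem covDerivCurvature_eq_zero (h : ∀ᶠ u' in 𝓝 u, ∀ x y z, curvature G u' x y z = 0)
    (w x y z : F) : covDerivCurvature G u w x y z = 0 := by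
  have h1 : (fun u' => curvature G u' x y z) =ᶠ[𝓝 u] fun _ => 0 := h.mono fun u' h' => h' x y z
  have h0 := h.self_of_nhds
  simp [covDerivCurvature, covDeriv, h1.fderiv_eq, h0]

end Germs

section Transition

variable {E : Type*} [NormedAddCommGroup E] [NormedSpace ℝ E]
  {H : Type*} [TopologicalSpace H] (I : ModelWithCorners ℝ E H)
  {M : Type*} [TopologicalSpace M] [ChartedSpace H M]

/-- The transition map from the preferred chart at `x` to the preferred chart at `x'`. -/
def transition (x x' : M) (u : E) : E :=
  extChartAt I x' ((extChartAt I x).symm u)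

/-- The domain of the transition map from the preferred chart at `x` to that at `x'`. -/
def transitionSource (x x' : M) : Set E :=
  (extChartAt I x).target ∩ (extChartAt I x).symm ⁻¹' (extChartAt I x').source

theorem contDiffOn_transition [IsManifold I ∞ M] (x x' : M) :
    ContDiffOn ℝ ∞ (transition I x x') (transitionSource I x x') :=
  contDiffOn_ext_coord_change x' x

theorem isOpen_transitionSource [I.Boundaryless] (x x' : M) : IsOpen (transitionSource I x x') :=
  (continuousOn_extChartAt_symm x).isOpen_inter_preimage (isOpen_extChartAt_target x)
    (isOpen_extChartAt_source x')

variable {I}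

theorem metricInChart_apply [IsManifold I 1 M]
    (h : ∀ x : M, TangentSpace I x →L[ℝ] TangentSpace I x →L[ℝ] ℝ) (x : M) {u : E}
    (hu : u ∈ (extChartAt I x).target) (a b : E) :
    metricInChart I h x u a b = h ((extChartAt I x).symm u)
      (tangentCoordChange I x ((extChartAt I x).symm u) ((extChartAt I x).symm u) a)
      (tangentCoordChange I x ((extChartAt I x).symm u) ((extChartAt I x).symm u) b) := by
  have hx := (extChartAt I x).map_target hu
  rw [extChartAt_source] at hx
  change h _ ((trivializationAt E (TangentSpace I : M → Type _) x).symmL ℝ _ a)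
    ((trivializationAt E (TangentSpace I : M → Type _) x).symmL ℝ _ b) = _
  rw [TangentBundle.symmL_trivializationAt_eq_core hx]
  rfl

variable [I.Boundaryless]

theorem contDiffAt_transition [IsManifold I ∞ M] {x x' : M} {u : E}
    (hu : u ∈ transitionSource I x x') : ContDiffAt ℝ ∞ (transition I x x') u :=
  (contDiffOn_transition I x x').contDiffAt ((isOpen_transitionSource I x x').mem_nhds hu)

theorem fderiv_transition [IsManifold I 1 M] {x x' : M} {u : E}
    (hu : u ∈ transitionSource I x x') :
    fderiv ℝ (transition I x x') u = tangentCoordChange I x x' ((extChartAt I x).symm u) := by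
  rw [tangentCoordChange_def, I.range_eq_univ, fderivWithin_univ, (extChartAt I x).right_inv hu.1]
  rfl

theorem isInvertible_fderiv_transition [IsManifold I 1 M] {x x' : M} {u : E}
    (hu : u ∈ transitionSource I x x') : (fderiv ℝ (transition I x x') u).IsInvertible := by
  rw [fderiv_transition hu]
  have hx := (extChartAt I x).map_target hu.1
  refine .of_inverse (g := tangentCoordChange I x' x ((extChartAt I x).symm u)) ?_ ?_
  · ext v
    rw [ContinuousLinearMap.comp_apply, tangentCoordChange_comp ⟨⟨hu.2, hx⟩, hu.2⟩,
      tangentCoordChange_self hu.2]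
    rfl
  · ext v
    rw [ContinuousLinearMap.comp_apply, tangentCoordChange_comp ⟨⟨hx, hu.2⟩, hx⟩,
      tangentCoordChange_self hx]
    rfl

theorem metricInChart_transition [IsManifold I 1 M]
    (h : ∀ x : M, TangentSpace I x →L[ℝ] TangentSpace I x →L[ℝ] ℝ) {x x' : M} {u : E}
    (hu : u ∈ transitionSource I x x') (a b : E) :
    metricInChart I h x u a b = metricInChart I h x' (transition I x x' u)
      (fderiv ℝ (transition I x x') u a) (fderiv ℝ (transition I x x') u b) := by
  have hx := (extChartAt I x).map_target hu.1
  have e : (extChartAt I x').symm (transition I x x' u) = (extChartAt I x).symm u :=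
    (extChartAt I x').left_inv hu.2
  have hm : transition I x x' u ∈ (extChartAt I x').target := (extChartAt I x').map_source hu.2
  rw [metricInChart_apply h x hu.1, metricInChart_apply h x' hm, fderiv_transition hu, e]
  have hc (v : E) := tangentCoordChange_comp (I := I) (v := v)
    ⟨⟨hx, hu.2⟩, mem_extChartAt_source ((extChartAt I x).symm u)⟩
  exact (congrArg₂ (fun v w : E => h ((extChartAt I x).symm u) v w) (hc a) (hc b)).symm

theorem isRiemannianOn_metricInChart [IsManifold I ∞ M] [FiniteDimensional ℝ E]
    (g : Bundle.ContMDiffRiemannianMetric I ∞ E (fun x : M => TangentSpace I x)) (x : M) :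
    IsRiemannianOn (metricInChart I g.inner x) (extChartAt I x).target where
  isOpen := isOpen_extChartAt_target x
  contDiffOn := by
    rw [contDiffOn_clm_apply]
    intro a
    rw [contDiffOn_clm_apply]
    intro b
    have hs (a : E) : ContMDiffOn I (I.prod 𝓘(ℝ, E)) ∞
        (fun y => Bundle.TotalSpace.mk' E y
          ((trivializationAt E (TangentSpace I : M → Type _) x).symmL ℝ y a))
        (chartAt H x).source := by
      refine ((trivializationAt E (TangentSpace I : M → Type _)
        x).contMDiffOn_section_baseSet_iff).2 ((contMDiffOn_const (c := a)).congr fun y hy => ?_)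
      rw [(trivializationAt E (TangentSpace I : M → Type _) x).symmL_apply hy,
        (trivializationAt E (TangentSpace I : M → Type _) x).apply_mk_symm hy]
    have h1 := (g.contMDiff.contMDiffOn (s := (chartAt H x).source)).clm_bundle_apply₂ (F₁ := E)
      (F₂ := E) (hs a) (hs b)
    have h2 : ContMDiffOn I 𝓘(ℝ, ℝ) ∞ (fun y => g.inner y
        ((trivializationAt E (TangentSpace I : M → Type _) x).symmL ℝ y a)
        ((trivializationAt E (TangentSpace I : M → Type _) x).symmL ℝ y b))
        (chartAt H x).source := fun y hy => (Bundle.contMDiffWithinAt_totalSpace.1 (h1 y hy)).2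
    exact (h2.comp (contMDiffOn_extChartAt_symm x) fun u hu => by
      have := (extChartAt I x).map_target hu
      rwa [extChartAt_source] at this).contDiffOn
  symm u hu v w := by
    rw [metricInChart_apply _ x hu, metricInChart_apply _ x hu]
    exact g.symm _ _ _
  pos u hu v hv := by
    rw [metricInChart_apply _ x hu]
    refine g.pos _ _ fun h0 => hv ?_
    have hx := (extChartAt I x).map_target hu
    have := tangentCoordChange_comp (I := I) (v := v) 
      ⟨⟨hx, mem_extChartAt_source ((extChartAt I x).symm u)⟩, hx⟩
    rw [tangentCoordChange_self hx] at this
    rw [← this]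
    exact (congrArg _ h0).trans (map_zero _)

/-- In the preferred chart at `x`, the curvature vanishes everywhere if the manifold is flat. -/
theorem curvature_metricInChart_eq_zero [IsManifold I ∞ M] [FiniteDimensional ℝ E]
    (g : Bundle.ContMDiffRiemannianMetric I ∞ E (fun x : M => TangentSpace I x))
    (hflat : IsFlat I g.inner) (x : M) {u : E} (hu : u ∈ (extChartAt I x).target) (a b c : E) :
    curvature (metricInChart I g.inner x) u a b c = 0 := by
  set x' := (extChartAt I x).symm u with hx'
  have hu' : u ∈ transitionSource I x x' := ⟨hu, mem_extChartAt_source x'⟩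
  have hev : ∀ᶠ w in 𝓝 u, w ∈ transitionSource I x x' :=
    (isOpen_transitionSource I x x').mem_nhds hu'
  have key := (isRiemannianOn_metricInChart g x).fderiv_curvature_of_isometry
    (isRiemannianOn_metricInChart g x') (f := transition I x x')
    (hev.mono fun w hw => contDiffAt_transition hw) hu (mem_extChartAt_target x')
    (hev.mono fun w hw => isInvertible_fderiv_transition hw)
    (hev.mono fun w hw => metricInChart_transition g.inner hw) a b c
  have h0 := hflat x' (fderiv ℝ (transition I x x') u a) (fderiv ℝ (transition I x x') u b)
    (fderiv ℝ (transition I x x') u c)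
  obtain ⟨e, he⟩ := isInvertible_fderiv_transition hu'
  rw [← he] at key h0
  exact e.injective ((key.trans h0).trans (map_zero e).symm)

end Transition

section SasakiInChart

variable {E : Type*} [NormedAddCommGroup E] [NormedSpace ℝ E]
  {H : Type*} [TopologicalSpace H] {I : ModelWithCorners ℝ E H}
  {M : Type*} [TopologicalSpace M] [ChartedSpace H M] [IsManifold I ∞ M]

theorem extChartAt_tangent_target (p : TangentBundle I M) :
    (extChartAt I.tangent p).target = (extChartAt I p.proj).target ×ˢ Set.univ := by
  rw [ModelWithCorners.tangent, FiberBundle.extChartAt_target]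
  congr 1
  refine Set.inter_eq_left.2 fun u hu => ?_
  have := (extChartAt I p.proj).map_target hu
  rwa [extChartAt_source] at this

theorem extChartAt_tangent_apply (p q : TangentBundle I M) :
    extChartAt I.tangent p q =
      ((extChartAt I p.proj q.proj, tangentCoordChange I q.proj p.proj q.proj q.snd) : E × E) := by
  rw [ModelWithCorners.tangent, FiberBundle.extChartAt]
  rfl

theorem extChartAt_tangent_self (p : TangentBundle I M) :
    extChartAt I.tangent p p = ((extChartAt I p.proj p.proj, p.snd) : E × E) := by
  rw [extChartAt_tangent_apply]
  exact Prod.ext rfl (tangentCoordChange_self (mem_extChartAt_source _))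

theorem extChartAt_tangent_symm_apply (p : TangentBundle I M) (w : E × E) :
    (extChartAt I.tangent p).symm w = (⟨(extChartAt I p.proj).symm w.1,
      tangentCoordChange I p.proj ((extChartAt I p.proj).symm w.1)
        ((extChartAt I p.proj).symm w.1) w.2⟩ : TangentBundle I M) := by
  rw [ModelWithCorners.tangent, FiberBundle.extChartAt]
  rfl

theorem mem_transitionSource_tangent (p q : TangentBundle I M) {w : E × E}
    (hw : w.1 ∈ transitionSource I p.proj q.proj) : w ∈ transitionSource I.tangent p q := by
  refine ⟨?_, ?_⟩
  · rw [extChartAt_tangent_target]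
    exact ⟨hw.1, Set.mem_univ _⟩
  · rw [Set.mem_preimage, extChartAt_source, TangentBundle.mem_chart_source_iff,
      extChartAt_tangent_symm_apply, ← extChartAt_source I]
    exact hw.2

variable [I.Boundaryless]

theorem transition_tangent (p q : TangentBundle I M) {w : E × E}
    (hw : w.1 ∈ transitionSource I p.proj q.proj) :
    transition I.tangent p q w =
      (transition I p.proj q.proj w.1, fderiv ℝ (transition I p.proj q.proj) w.1 w.2) := by
  have hx := (extChartAt I p.proj).map_target hw.1
  rw [transition, extChartAt_tangent_symm_apply, extChartAt_tangent_apply,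
    fderiv_transition hw]
  refine Prod.ext rfl ?_
  exact tangentCoordChange_comp ⟨⟨hx, mem_extChartAt_source _⟩, hw.2⟩

theorem fderiv_transition_tangent (p q : TangentBundle I M) {w : E × E}
    (hw : w.1 ∈ transitionSource I p.proj q.proj) (ξ : E × E) :
    fderiv ℝ (transition I.tangent p q) w ξ =
      (fderiv ℝ (transition I p.proj q.proj) w.1 ξ.1,
        fderiv ℝ (fderiv ℝ (transition I p.proj q.proj)) w.1 ξ.1 w.2
          + fderiv ℝ (transition I p.proj q.proj) w.1 ξ.2) := by
  have h : transition I.tangent p q =ᶠ[𝓝 w] fun w' : E × E =>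
      (transition I p.proj q.proj w'.1, fderiv ℝ (transition I p.proj q.proj) w'.1 w'.2) := by
    filter_upwards [continuousAt_fst.preimage_mem_nhds
      ((isOpen_transitionSource I p.proj q.proj).mem_nhds hw)] with w' hw'
    exact transition_tangent p q hw'
  have hf := contDiffAt_transition hw
  have hf1 := (hf.differentiableAt (by simp)).hasFDerivAt.comp w hasFDerivAt_fst
  have hf2 := (((hf.fderiv_right (m := ∞) (by simp)).differentiableAt
    (by simp)).hasFDerivAt.comp w hasFDerivAt_fst).clm_apply (hasFDerivAt_snd (𝕜 := ℝ) (p := w))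
  have h3 := hf1.prodMk hf2
  rw [h.fderiv_eq]
  have h4 : HasFDerivAt (fun w' : E × E => (transition I p.proj q.proj w'.1,
    fderiv ℝ (transition I p.proj q.proj) w'.1 w'.2)) _ w := h3
  rw [h4.fderiv]
  simp [add_comm]

theorem verticalPart_fderiv_transition_tangent [FiniteDimensional ℝ E]
    (g : Bundle.ContMDiffRiemannianMetric I ∞ E (fun x : M => TangentSpace I x))
    (p q : TangentBundle I M) {w : E × E} (hw : w.1 ∈ transitionSource I p.proj q.proj)
    (hq : transition I p.proj q.proj w.1 = extChartAt I q.proj q.proj)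
    (hq' : fderiv ℝ (transition I p.proj q.proj) w.1 w.2 = (q.snd : E)) (ξ : E × E) :
    verticalPart I g.inner q (fderiv ℝ (transition I.tangent p q) w ξ) =
      fderiv ℝ (transition I p.proj q.proj) w.1
        (connector (metricInChart I g.inner p.proj) w ξ) := by
  have hev : ∀ᶠ u in 𝓝 w.1, u ∈ transitionSource I p.proj q.proj :=
    (isOpen_transitionSource I p.proj q.proj).mem_nhds hw
  have hf := contDiffAt_transition hw
  have h1 := (isRiemannianOn_metricInChart g p.proj).fderiv_christoffel_of_isometry
    (isRiemannianOn_metricInChart g q.proj) hf hw.1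
    (by rw [hq]; exact mem_extChartAt_target q.proj) (isInvertible_fderiv_transition hw)
    (hev.mono fun w hw => metricInChart_transition g.inner hw) w.2 ξ.1
  have hsymm : fderiv ℝ (fderiv ℝ (transition I p.proj q.proj)) w.1 ξ.1 w.2 =
      fderiv ℝ (fderiv ℝ (transition I p.proj q.proj)) w.1 w.2 ξ.1 :=
    (hf.isSymmSndFDerivAt (by simpa using ENat.LEInfty.out)) _ _
  rw [fderiv_transition_tangent p q hw, connector_apply, map_add, h1, hq, hq', hsymm]
  change (_ + _) + christoffel (metricInChart I g.inner q.proj) (extChartAt I q.proj q.proj) q.snd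
    (fderiv ℝ (transition I p.proj q.proj) w.1 ξ.1) = _
  abel

/-- In the chart of `TM` induced by a chart of `M`, the Sasaki metric is the Sasaki metric of the
coordinate expression of `g`. -/
theorem metricInChart_sasakiMetric [FiniteDimensional ℝ E]
    (g : Bundle.ContMDiffRiemannianMetric I ∞ E (fun x : M => TangentSpace I x))
    (p : TangentBundle I M) {w : E × E} (hw : w.1 ∈ (extChartAt I p.proj).target) :
    metricInChart I.tangent (sasakiMetric I g.inner) p w =
      sasakiCoord (metricInChart I g.inner p.proj) w := by
  have hw' : w ∈ (extChartAt I.tangent p).target := by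
    rw [extChartAt_tangent_target]
    exact ⟨hw, Set.mem_univ _⟩
  set q := (extChartAt I.tangent p).symm w with hq
  have hproj : q.proj = (extChartAt I p.proj).symm w.1 := by
    rw [hq, extChartAt_tangent_symm_apply]
  have hs : w.1 ∈ transitionSource I p.proj q.proj :=
    ⟨hw, by rw [Set.mem_preimage, ← hproj]; exact mem_extChartAt_source _⟩
  have hf := fderiv_transition hs
  have hv := verticalPart_fderiv_transition_tangent g p q hs (by rw [transition, ← hproj])
    (by rw [hf]; rfl)
  have hcc : tangentCoordChange I.tangent p q q = fderiv ℝ (transition I.tangent p q) w :=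
    (fderiv_transition (mem_transitionSource_tangent p q hs)).symm
  have hg (a b : E) : g.inner q.proj (fderiv ℝ (transition I p.proj q.proj) w.1 a)
      (fderiv ℝ (transition I p.proj q.proj) w.1 b) = metricInChart I g.inner p.proj w.1 a b := by
    rw [metricInChart_apply g.inner p.proj hw, hf]
    rfl
  refine ContinuousLinearMap.ext fun ξ => ContinuousLinearMap.ext fun η => ?_
  rw [metricInChart_apply _ p hw', sasakiCoord_apply, ← hg, ← hg, ← hv, ← hv]
  have hh (ξ : E × E) : horizontalPart I q (fderiv ℝ (transition I.tangent p q) w ξ) =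
      fderiv ℝ (transition I p.proj q.proj) w.1 ξ.1 :=
    congrArg Prod.fst (fderiv_transition_tangent p q hs ξ)
  rw [← hh, ← hh, ← hcc]
  rfl

end SasakiInChart

theorem isOneForm_zero {E : Type*} [NormedAddCommGroup E] [NormedSpace ℝ E]
    {H : Type*} [TopologicalSpace H] {I : ModelWithCorners ℝ E H}
    {N : Type*} [TopologicalSpace N] [ChartedSpace H N] [IsManifold I ∞ N] :
    IsOneForm I (fun _ : N => 0) :=
  Bundle.contMDiff_zeroSection ℝ (fun x : N => TangentSpace I x →L[ℝ] ℝ)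

section Main

variable {E : Type*} [NormedAddCommGroup E] [NormedSpace ℝ E] [FiniteDimensional ℝ E]
  {H : Type*} [TopologicalSpace H] {I : ModelWithCorners ℝ E H} [I.Boundaryless]
  {M : Type*} [TopologicalSpace M] [ChartedSpace H M] [IsManifold I ∞ M]
  (g : Bundle.ContMDiffRiemannianMetric I ∞ E (fun x : M => TangentSpace I x))

theorem metricInChart_sasakiMetric_eventuallyEq (p : TangentBundle I M) :
    metricInChart I.tangent (sasakiMetric I g.inner) p
      =ᶠ[𝓝 ((extChartAt I p.proj p.proj, p.snd) : E × E)]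
        sasakiCoord (metricInChart I g.inner p.proj) := by
  filter_upwards [continuousAt_fst.preimage_mem_nhds
    ((isOpen_extChartAt_target (I := I) p.proj).mem_nhds (mem_extChartAt_target p.proj))] with w hw
  exact metricInChart_sasakiMetric g p hw

theorem riemann_sasakiMetric (p : TangentBundle I M) (X Y Z : TangentSpace I.tangent p) :
    riemann I.tangent (sasakiMetric I g.inner) p X Y Z =
      curvature (F := E × E) (sasakiCoord (metricInChart I g.inner p.proj))
        (extChartAt I p.proj p.proj, p.snd) X Y Z := by
  rw [riemann, extChartAt_tangent_self,
    curvature_congr (metricInChart_sasakiMetric_eventuallyEq g p)]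

theorem nablaRiemann_sasakiMetric (p : TangentBundle I M) (W X Y Z : TangentSpace I.tangent p) :
    nablaRiemann I.tangent (sasakiMetric I g.inner) p W X Y Z =
      covDerivCurvature (F := E × E) (sasakiCoord (metricInChart I g.inner p.proj))
        (extChartAt I p.proj p.proj, p.snd) W X Y Z := by
  rw [nablaRiemann, extChartAt_tangent_self,
    covDerivCurvature_congr (metricInChart_sasakiMetric_eventuallyEq g p)]

variable {g}

theorem IsFlat.isFlat_sasakiMetric (h : IsFlat I g.inner) :
    IsFlat I.tangent (sasakiMetric I g.inner) := fun p X Y Z => by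
  rw [riemann_sasakiMetric]
  exact (isRiemannianOn_metricInChart g p.proj).curvature_sasakiCoord_eq_zero
    (fun u hu => curvature_metricInChart_eq_zero g h p.proj hu) (mem_extChartAt_target p.proj) _ _ _

theorem IsFlat.isLocallySymmetric_sasakiMetric (h : IsFlat I g.inner) :
    IsLocallySymmetric I.tangent (sasakiMetric I g.inner) := fun p W X Y Z => by
  rw [nablaRiemann_sasakiMetric]
  refine covDerivCurvature_eq_zero (F := E × E) ?_ _ _ _ _
  filter_upwards [continuousAt_fst.preimage_mem_nhds ((isOpen_extChartAt_target (I := I)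
    p.proj).mem_nhds (mem_extChartAt_target p.proj))] with w hw
  exact (isRiemannianOn_metricInChart g p.proj).curvature_sasakiCoord_eq_zero
    (fun u hu => curvature_metricInChart_eq_zero g h p.proj hu) hw

/-- If the equation of weak symmetry holds pointwise on `TM`, with arbitrary linear forms, then `M`
is flat. -/
theorem isFlat_of_sasakiMetric_weaklySymmetric
    (h : ∀ p : TangentBundle I M, ∃ α₁ α₂ : TangentSpace I.tangent p →L[ℝ] ℝ,
      ∀ W X Y Z : TangentSpace I.tangent p,
      nablaRiemann I.tangent (sasakiMetric I g.inner) p W X Y Z =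
        α₁ W • riemann I.tangent (sasakiMetric I g.inner) p X Y Z
          + α₂ X • riemann I.tangent (sasakiMetric I g.inner) p W Y Z
          + α₂ Y • riemann I.tangent (sasakiMetric I g.inner) p X W Z
          + α₂ Z • riemann I.tangent (sasakiMetric I g.inner) p X Y W
          + sasakiMetric I g.inner p (riemann I.tangent (sasakiMetric I g.inner) p X Y Z) W
            • sharp I.tangent (sasakiMetric I g.inner) p α₂) :
    IsFlat I g.inner := fun x X Y Z => by
  obtain ⟨α₁, α₂, h⟩ := h ⟨x, X⟩
  simp only [riemann_sasakiMetric, nablaRiemann_sasakiMetric] at h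
  exact (isRiemannianOn_metricInChart g x).curvature_eq_zero_of_weaklySymmetric
    (p := ((extChartAt I x x, X) : E × E)) (mem_extChartAt_target x) α₁ α₂ _ _ h Y Z

end Main

end SasakiLift

end

open SasakiLift

theorem stmt_10 {n : ℕ} (hn : 3 ≤ n) {M : Type*} [TopologicalSpace M]
    [ChartedSpace (EuclideanSpace ℝ (Fin n)) M] [IsManifold (𝓡 n) ∞ M]
    (g : Bundle.ContMDiffRiemannianMetric (𝓡 n) ∞ (EuclideanSpace ℝ (Fin n))
      (fun x : M => TangentSpace (𝓡 n) x)) :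
    (IsWeaklySymmetric (𝓡 n).tangent (sasakiMetric (𝓡 n) g.inner) ↔ IsFlat (𝓡 n) g.inner) ∧
    (IsRecurrent (𝓡 n).tangent (sasakiMetric (𝓡 n) g.inner) ↔ IsFlat (𝓡 n) g.inner) ∧
    (IsPseudoSymmetric (𝓡 n).tangent (sasakiMetric (𝓡 n) g.inner) ↔ IsFlat (𝓡 n) g.inner) ∧
    (IsLocallySymmetric (𝓡 n).tangent (sasakiMetric (𝓡 n) g.inner) ↔ IsFlat (𝓡 n) g.inner) ∧
    (IsFlat (𝓡 n) g.inner → IsFlat (𝓡 n).tangent (sasakiMetric (𝓡 n) g.inner)) := by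
  have hz : IsOneForm (𝓡 n).tangent (fun _ : TangentBundle (𝓡 n) M => 0) := isOneForm_zero
  refine ⟨⟨?_, fun h => ?_⟩, ⟨?_, fun h => ?_⟩, ⟨?_, fun h => ?_⟩, ⟨fun h => ?_, fun h => ?_⟩,
    fun h => h.isFlat_sasakiMetric⟩
  · rintro ⟨α₁, α₂, -, -, h⟩
    exact isFlat_of_sasakiMetric_weaklySymmetric fun p => ⟨α₁ p, α₂ p, h p⟩
  · refine ⟨_, _, hz, hz, fun p W X Y Z => ?_⟩
    rw [h.isLocallySymmetric_sasakiMetric p W X Y Z]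
    simp [h.isFlat_sasakiMetric p]
  · rintro ⟨α₁, -, h⟩
    refine isFlat_of_sasakiMetric_weaklySymmetric fun p => ⟨α₁ p, 0, fun W X Y Z => ?_⟩
    rw [h p W X Y Z]
    simp [sharp]
  · refine ⟨_, hz, fun p W X Y Z => ?_⟩
    rw [h.isLocallySymmetric_sasakiMetric p W X Y Z]
    simp
  · rintro ⟨α₂, -, h⟩
    refine isFlat_of_sasakiMetric_weaklySymmetric fun p => ⟨(2 : ℝ) • α₂ p, α₂ p, fun W X Y Z => ?_⟩
    rw [h p W X Y Z]
    simp
  · refine ⟨_, hz, fun p W X Y Z => ?_⟩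
    rw [h.isLocallySymmetric_sasakiMetric p W X Y Z]
    simp [h.isFlat_sasakiMetric p]
  · refine isFlat_of_sasakiMetric_weaklySymmetric fun p => ⟨0, 0, fun W X Y Z => ?_⟩
    rw [h p W X Y Z]
    simp [sharp]
  · exact h.isLocallySymmetric_sasakiMetric
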